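/- arXiv:math/9910116 — 8 statements merged into one kernel-verified Lean document; each statement's English description precedes it below -/
import Mathlib

section
/- Let ∘ be an A-bilinear, commutative and associative multiplication on T = Der_K(A) and let ∇ be a torsion-free connection on T. If the (3,1)-tensor ∇∘ is symmetric in all three of its arguments, i.e. ∇∘(X,Y,Z) = ∇∘(Y,X,Z) = ∇∘(X,Z,Y) for all X,Y,Z ∈ T, then the multiplication satisfies the integrability condition: for all X,Y,Z,W ∈ T, ⁅X∘Y, Z∘W⁆ − ⁅X∘Y,Z⁆∘W − ⁅X∘Y,W⁆∘Z − X∘⁅Y,Z∘W⁆ + X∘⁅Y,Z⁆∘W + X∘⁅Y,W⁆∘Z − Y∘⁅X,Z∘W⁆ + Y∘⁅X,Z⁆∘W + Y∘⁅X,W⁆∘Z = 0. (Theorem 5.2) -/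
/-- **Theorem 5.2.** Let `∘` be an `A`-bilinear, commutative and associative multiplication
on `T = Der_K(A)` and `∇` a torsion-free connection on `T`. If the `(3,1)`-tensor `∇∘` is
symmetric in all three arguments, then the multiplication satisfies the integrability
condition. -/
theorem stmt_0
    (K : Type*) [Field K] [CharZero K]
    (A : Type*) [CommRing A] [Algebra K A]
    (mul : Derivation K A A → Derivation K A A → Derivation K A A)
    (mul_add : ∀ X X' Y : Derivation K A A, mul (X + X') Y = mul X Y + mul X' Y)
    (mul_smul : ∀ (f : A) (X Y : Derivation K A A), mul (f • X) Y = f • mul X Y)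
    (mul_comm : ∀ X Y : Derivation K A A, mul X Y = mul Y X)
    (mul_assoc : ∀ X Y Z : Derivation K A A, mul (mul X Y) Z = mul X (mul Y Z))
    (nabla : Derivation K A A → Derivation K A A → Derivation K A A)
    (nabla_addX : ∀ X X' Y : Derivation K A A, nabla (X + X') Y = nabla X Y + nabla X' Y)
    (nabla_smulX : ∀ (f : A) (X Y : Derivation K A A), nabla (f • X) Y = f • nabla X Y)
    (nabla_addY : ∀ X Y Y' : Derivation K A A, nabla X (Y + Y') = nabla X Y + nabla X Y')
    (nabla_leibniz : ∀ (f : A) (X Y : Derivation K A A),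
      nabla X (f • Y) = X f • Y + f • nabla X Y)
    (torsion_free : ∀ X Y : Derivation K A A, nabla X Y - nabla Y X = ⁅X, Y⁆)
    (nabla_mul_symm12 : ∀ X Y Z : Derivation K A A,
      nabla X (mul Y Z) - mul (nabla X Y) Z - mul Y (nabla X Z) =
        nabla Y (mul X Z) - mul (nabla Y X) Z - mul X (nabla Y Z))
    (nabla_mul_symm23 : ∀ X Y Z : Derivation K A A,
      nabla X (mul Y Z) - mul (nabla X Y) Z - mul Y (nabla X Z) =
        nabla X (mul Z Y) - mul (nabla X Z) Y - mul Z (nabla X Y)) :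
    ∀ X Y Z W : Derivation K A A,
      ⁅mul X Y, mul Z W⁆ - mul ⁅mul X Y, Z⁆ W - mul ⁅mul X Y, W⁆ Z
        - mul X ⁅Y, mul Z W⁆ + mul (mul X ⁅Y, Z⁆) W + mul (mul X ⁅Y, W⁆) Z
        - mul Y ⁅X, mul Z W⁆ + mul (mul Y ⁅X, Z⁆) W + mul (mul Y ⁅X, W⁆) Z = 0 := by
  intro X Y Z W
  have mul_add' (X Y Y' : Derivation K A A) : mul X (Y + Y') = mul X Y + mul X Y' := by
    rw [mul_comm, mul_add, mul_comm Y, mul_comm Y']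
  let mulLeft (X : Derivation K A A) : Derivation K A A →+ Derivation K A A :=
    AddMonoidHom.mk' (mul X) (mul_add' X)
  have mul_sub' (X Y Y' : Derivation K A A) : mul X (Y - Y') = mul X Y - mul X Y' :=
    map_sub (mulLeft X) Y Y'
  have sub_mul' (X X' Y : Derivation K A A) : mul (X - X') Y = mul X Y - mul X' Y := by
    rw [mul_comm, mul_sub', mul_comm Y, mul_comm Y]
  have mul_left_comm' (X Y Z : Derivation K A A) : mul X (mul Y Z) = mul Y (mul X Z) := by
    rw [← mul_assoc, mul_comm X, mul_assoc]
  have hXY := nabla_mul_symm12 (mul X Y) Z W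
  have hZW := nabla_mul_symm12 (mul Z W) X Y
  have hYW := nabla_mul_symm12 Z X (mul Y W)
  have hW := congrArg (mul Z) (nabla_mul_symm12 W X Y)
  have hY := congrArg (mul X) (nabla_mul_symm12 Y Z W)
  rw [← sub_eq_zero] at hXY hZW hYW hW hY
  have key := congrArg₂ (· + ·) (congrArg₂ (· - ·) hXY hZW)
    (congrArg₂ (· + ·) hYW (congrArg₂ (· - ·) hW hY))
  simp only [add_zero, sub_zero] at key
  rw [← key]
  simp only [← torsion_free, mul_sub', sub_mul', mul_assoc, mul_comm, mul_left_comm']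
  abel
end

section
/- Let ∘ be an A-bilinear, commutative and associative multiplication on T = Der_K(A) with unit field e, let g be a metric on T such that the (3,0)-tensor A(X,Y,Z) := g(X, Y∘Z) is symmetric in all three arguments (multiplication invariance), and let ∇ be a torsion-free connection on T that is metric for g. Define ∇A(X,Y,Z,W) := X(A(Y,Z,W)) − A(∇_X Y,Z,W) − A(Y,∇_X Z,W) − A(Y,Z,∇_X W), and the coidentity ε(X) := g(X,e). Then the following three conditions are equivalent: (i) the multiplication satisfies the integrability condition and ε is closed, i.e. X(ε(Y)) − Y(ε(X)) − ε(⁅X,Y⁆) = 0 for all X,Y; (ii) ∇A is symmetric in all four arguments; (iii) ∇∘ is symmetric in all three arguments. (Theorem 5.3) -/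
namespace Stmt1

variable {K A : Type*} [Field K] [CharZero K] [CommRing A] [Algebra K A]

/-- The integrability condition for a multiplication on `Der_K(A)`. -/
def Integrability (mul : Derivation K A A → Derivation K A A → Derivation K A A) : Prop :=
  ∀ X Y Z W : Derivation K A A,
    ⁅mul X Y, mul Z W⁆ - mul ⁅mul X Y, Z⁆ W - mul ⁅mul X Y, W⁆ Z
      - mul X ⁅Y, mul Z W⁆ + mul (mul X ⁅Y, Z⁆) W + mul (mul X ⁅Y, W⁆) Z
      - mul Y ⁅X, mul Z W⁆ + mul (mul Y ⁅X, Z⁆) W + mul (mul Y ⁅X, W⁆) Z = 0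

/-- The coidentity `ε(X) := g(X,e)` is closed. -/
def EpsClosed (g : Derivation K A A → Derivation K A A → A) (e : Derivation K A A) : Prop :=
  ∀ X Y : Derivation K A A, X (g Y e) - Y (g X e) - g ⁅X, Y⁆ e = 0

/-- The covariant derivative `∇∘(X,Y,Z)` of the multiplication. -/
def NablaCirc (mul nabla : Derivation K A A → Derivation K A A → Derivation K A A)
    (X Y Z : Derivation K A A) : Derivation K A A :=
  nabla X (mul Y Z) - mul (nabla X Y) Z - mul Y (nabla X Z)

/-- `∇∘` is symmetric in all three arguments. -/
def NablaCircSymm (mul nabla : Derivation K A A → Derivation K A A → Derivation K A A) : Prop :=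
  ∀ X Y Z : Derivation K A A,
    NablaCirc mul nabla X Y Z = NablaCirc mul nabla Y X Z ∧
    NablaCirc mul nabla X Y Z = NablaCirc mul nabla X Z Y

/-- The covariant derivative `∇A(X,Y,Z,W)` of the tensor `A(Y,Z,W) = g(Y, Z∘W)`. -/
def NablaA (mul nabla : Derivation K A A → Derivation K A A → Derivation K A A)
    (g : Derivation K A A → Derivation K A A → A)
    (X Y Z W : Derivation K A A) : A :=
  X (g Y (mul Z W)) - g (nabla X Y) (mul Z W)
    - g Y (mul (nabla X Z) W) - g Y (mul Z (nabla X W))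

/-- `∇A` is symmetric in all four arguments. -/
def NablaASymm (mul nabla : Derivation K A A → Derivation K A A → Derivation K A A)
    (g : Derivation K A A → Derivation K A A → A) : Prop :=
  ∀ X Y Z W : Derivation K A A,
    NablaA mul nabla g X Y Z W = NablaA mul nabla g Y X Z W ∧
    NablaA mul nabla g X Y Z W = NablaA mul nabla g X Z Y W ∧
    NablaA mul nabla g X Y Z W = NablaA mul nabla g X Y W Z

/-- The integrability condition, expressed through the covariant derivative of the
multiplication along a torsion-free connection. -/
theorem integrability_iff_nablaCirc
    {K A : Type*} [Field K] [CommRing A] [Algebra K A]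
    {mul nabla : Derivation K A A → Derivation K A A → Derivation K A A}
    (mul_sub : ∀ X X' Y : Derivation K A A, mul (X - X') Y = mul X Y - mul X' Y)
    (mul_comm : ∀ X Y : Derivation K A A, mul X Y = mul Y X)
    (mul_assoc : ∀ X Y Z : Derivation K A A, mul (mul X Y) Z = mul X (mul Y Z))
    (torsion_free : ∀ X Y : Derivation K A A, nabla X Y - nabla Y X = ⁅X, Y⁆) :
    Integrability mul ↔ ∀ X Y Z W : Derivation K A A,
      NablaCirc mul nabla (mul X Y) Z W - mul X (NablaCirc mul nabla Y Z W)
        - mul Y (NablaCirc mul nabla X Z W) - NablaCirc mul nabla (mul Z W) X Y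
        + mul Z (NablaCirc mul nabla W X Y) + mul W (NablaCirc mul nabla Z X Y) = 0 := by
  have mul_sub_right (X Y Y' : Derivation K A A) : mul X (Y - Y') = mul X Y - mul X Y' := by
    rw [mul_comm, mul_sub, mul_comm Y, mul_comm Y']
  have mul_left_comm (X Y Z : Derivation K A A) : mul X (mul Y Z) = mul Y (mul X Z) := by
    rw [← mul_assoc, mul_comm X, mul_assoc]
  refine forall₄_congr fun X Y Z W => ?_
  simp only [NablaCirc, ← torsion_free, mul_sub, mul_sub_right]
  refine iff_of_eq (congrArg (· = 0) ?_)
  simp only [mul_assoc, mul_comm, mul_left_comm]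
  abel

/-- The covariant derivative of the associativity law. -/
theorem nablaCirc_assoc
    {K A : Type*} [Field K] [CommRing A] [Algebra K A]
    {mul nabla : Derivation K A A → Derivation K A A → Derivation K A A}
    (mul_sub : ∀ X X' Y : Derivation K A A, mul (X - X') Y = mul X Y - mul X' Y)
    (mul_comm : ∀ X Y : Derivation K A A, mul X Y = mul Y X)
    (mul_assoc : ∀ X Y Z : Derivation K A A, mul (mul X Y) Z = mul X (mul Y Z))
    (X Y Z W : Derivation K A A) :
    NablaCirc mul nabla Z (mul X Y) W + mul W (NablaCirc mul nabla Z X Y) =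
      NablaCirc mul nabla Z X (mul Y W) + mul X (NablaCirc mul nabla Z Y W) := by
  have mul_sub_right (X Y Y' : Derivation K A A) : mul X (Y - Y') = mul X Y - mul X Y' := by
    rw [mul_comm, mul_sub, mul_comm Y, mul_comm Y']
  have mul_left_comm (X Y Z : Derivation K A A) : mul X (mul Y Z) = mul Y (mul X Z) := by
    rw [← mul_assoc, mul_comm X, mul_assoc]
  simp only [NablaCirc, mul_sub_right]
  simp only [mul_assoc, mul_comm, mul_left_comm]
  abel

/-- **Theorem 5.3.** For a commutative associative multiplication with unit field `e`, a
multiplication-invariant metric `g` and its Levi-Civita (torsion-free, metric) connection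
`∇`, the following are equivalent: (i) the integrability condition holds and the coidentity
`ε` is closed; (ii) `∇A` is symmetric in all four arguments; (iii) `∇∘` is symmetric in all
three arguments. -/
theorem stmt_1
    (mul : Derivation K A A → Derivation K A A → Derivation K A A)
    (mul_add : ∀ X X' Y : Derivation K A A, mul (X + X') Y = mul X Y + mul X' Y)
    (mul_smul : ∀ (f : A) (X Y : Derivation K A A), mul (f • X) Y = f • mul X Y)
    (mul_comm : ∀ X Y : Derivation K A A, mul X Y = mul Y X)
    (mul_assoc : ∀ X Y Z : Derivation K A A, mul (mul X Y) Z = mul X (mul Y Z))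
    (e : Derivation K A A)
    (e_unit : ∀ X : Derivation K A A, mul e X = X)
    (g : Derivation K A A → Derivation K A A → A)
    (g_add : ∀ X X' Y : Derivation K A A, g (X + X') Y = g X Y + g X' Y)
    (g_smul : ∀ (f : A) (X Y : Derivation K A A), g (f • X) Y = f * g X Y)
    (g_symm : ∀ X Y : Derivation K A A, g X Y = g Y X)
    (g_nondeg : ∀ X : Derivation K A A, (∀ Y : Derivation K A A, g X Y = 0) → X = 0)
    (g_mul_invariant : ∀ X Y Z : Derivation K A A, g X (mul Y Z) = g Y (mul X Z))
    (nabla : Derivation K A A → Derivation K A A → Derivation K A A)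
    (nabla_addX : ∀ X X' Y : Derivation K A A, nabla (X + X') Y = nabla X Y + nabla X' Y)
    (nabla_smulX : ∀ (f : A) (X Y : Derivation K A A), nabla (f • X) Y = f • nabla X Y)
    (nabla_addY : ∀ X Y Y' : Derivation K A A, nabla X (Y + Y') = nabla X Y + nabla X Y')
    (nabla_leibniz : ∀ (f : A) (X Y : Derivation K A A),
      nabla X (f • Y) = X f • Y + f • nabla X Y)
    (torsion_free : ∀ X Y : Derivation K A A, nabla X Y - nabla Y X = ⁅X, Y⁆)
    (nabla_metric : ∀ X Y Z : Derivation K A A,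
      X (g Y Z) = g (nabla X Y) Z + g Y (nabla X Z)) :
    ((Integrability mul ∧ EpsClosed g e) ↔ NablaASymm mul nabla g) ∧
    (NablaASymm mul nabla g ↔ NablaCircSymm mul nabla) := by
  have mul_sub (X X' Y : Derivation K A A) : mul (X - X') Y = mul X Y - mul X' Y := by
    rw [eq_sub_iff_add_eq, ← mul_add, sub_add_cancel]
  have g_sub (X X' Y : Derivation K A A) : g (X - X') Y = g X Y - g X' Y := by
    rw [eq_sub_iff_add_eq, ← g_add, sub_add_cancel]
  have g_sub_right (X Y Y' : Derivation K A A) : g X (Y - Y') = g X Y - g X Y' := by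
    rw [g_symm, g_sub, g_symm Y, g_symm Y']
  have g_add_right (X Y Y' : Derivation K A A) : g X (Y + Y') = g X Y + g X Y' := by
    rw [g_symm, g_add, g_symm Y, g_symm Y']
  have g_zero_right (X : Derivation K A A) : g X 0 = 0 := by
    simpa using g_sub_right X 0 0
  have g_ext (X X' : Derivation K A A) (h : ∀ Y, g Y X = g Y X') : X = X' :=
    sub_eq_zero.1 <| g_nondeg _ fun Y => by rw [g_symm, g_sub_right, h, sub_self]
  have mul_e (X : Derivation K A A) : mul X e = X := by rw [mul_comm, e_unit]
  have circ_swap (X Y Z : Derivation K A A) :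
      NablaCirc mul nabla X Y Z = NablaCirc mul nabla X Z Y := by
    simp only [NablaCirc, mul_comm]
    abel
  have nablaA_eq (X Y Z W : Derivation K A A) :
      NablaA mul nabla g X Y Z W = g Y (NablaCirc mul nabla X Z W) := by
    simp only [NablaA, NablaCirc, nabla_metric, g_sub_right]
    ring
  have nablaA_swap_right (X Y Z W : Derivation K A A) :
      NablaA mul nabla g X Y Z W = NablaA mul nabla g X Y W Z := by
    rw [nablaA_eq, nablaA_eq, circ_swap]
  have nablaA_swap (X Y Z W : Derivation K A A) :
      NablaA mul nabla g X Y Z W = NablaA mul nabla g X Z Y W := by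
    simp only [NablaA]
    rw [g_mul_invariant Y Z W, g_mul_invariant (nabla X Y) Z W,
      g_mul_invariant Y (nabla X Z) W, g_mul_invariant Y Z (nabla X W)]
    ring
  have symm_iff : NablaASymm mul nabla g ↔ NablaCircSymm mul nabla := by
    refine ⟨fun h X Y Z => ⟨g_ext _ _ fun V => ?_, circ_swap X Y Z⟩, fun h X Y Z W => ?_⟩
    · rw [← nablaA_eq, ← nablaA_eq, nablaA_swap, (h X Y V Z).1, nablaA_swap]
    · refine ⟨?_, nablaA_swap X Y Z W, nablaA_swap_right X Y Z W⟩
      rw [nablaA_swap, nablaA_eq, (h X Y W).1, ← nablaA_eq, nablaA_swap]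
  have circ_e (X Y : Derivation K A A) :
      NablaCirc mul nabla X Y e = mul Y (NablaCirc mul nabla X e e) := by
    have h := nablaCirc_assoc (nabla := nabla) mul_sub mul_comm mul_assoc Y e X e
    simp only [mul_e, e_unit] at h
    exact add_left_cancel h
  have closed_iff : EpsClosed g e ↔ ∀ X Y : Derivation K A A,
      NablaA mul nabla g X Y e e = NablaA mul nabla g Y X e e := by
    refine forall₂_congr fun X Y => ?_
    simp only [NablaA, ← torsion_free, nabla_metric, g_sub, mul_e, e_unit]
    constructor <;> intro h <;> linear_combination -h
  refine ⟨⟨fun ⟨hint, hclosed⟩ => ?_, fun h => ?_⟩, symm_iff⟩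
  · rw [integrability_iff_nablaCirc mul_sub mul_comm mul_assoc torsion_free] at hint
    rw [closed_iff] at hclosed
    have nablaA_e (X Y Z : Derivation K A A) :
        NablaA mul nabla g X e Y Z = NablaA mul nabla g X (mul Y Z) e e := by
      rw [nablaA_swap, nablaA_swap_right, nablaA_eq, nablaA_eq, circ_e, g_symm (mul Y Z),
        g_mul_invariant _ Y Z, mul_comm]
    have balance (X Y Z W : Derivation K A A) :
        NablaA mul nabla g X Y Z W + NablaA mul nabla g Y X Z W =
          NablaA mul nabla g Z W X Y + NablaA mul nabla g W Z X Y := by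
      have h := congrArg (g e) (hint X Y Z W)
      simp only [g_add_right, g_sub_right, g_zero_right, g_mul_invariant e, e_unit,
        ← nablaA_eq, nablaA_e] at h
      linear_combination -h + hclosed (mul X Y) (mul Z W)
    have two_mul_cancel (a b : A) (h : 2 * a = 2 * b) : a = b := by
      have h2 : (2 : K) • a = (2 : K) • b := by
        rw [two_smul, two_smul, ← two_mul, ← two_mul, h]
      exact smul_right_injective A (two_ne_zero' K) h2
    refine fun X Y Z W => ⟨two_mul_cancel _ _ ?_, nablaA_swap X Y Z W, nablaA_swap_right X Y Z W⟩
    linear_combination balance X Z Y W + balance X W Y Z - nablaA_swap X Z Y W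
      - nablaA_swap Z X Y W - nablaA_swap X W Y Z - nablaA_swap_right X Y W Z
      - nablaA_swap W X Y Z + nablaA_swap Y Z X W + nablaA_swap Y W X Z
      + nablaA_swap_right Y X W Z
  · have hcirc := symm_iff.1 h
    refine ⟨?_, closed_iff.2 fun X Y => (h X Y e e).1⟩
    rw [integrability_iff_nablaCirc mul_sub mul_comm mul_assoc torsion_free]
    intro X Y Z W
    have hZ := nablaCirc_assoc (nabla := nabla) mul_sub mul_comm mul_assoc X Y Z W
    have hX := nablaCirc_assoc (nabla := nabla) mul_sub mul_comm mul_assoc Y W X Z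
    rw [(hcirc Z X (mul Y W)).1, circ_swap X Z] at hZ
    rw [(hcirc (mul X Y) Z W).1, (hcirc Y Z W).1, circ_swap X Z W, (hcirc (mul Z W) X Y).1,
      circ_swap X (mul Z W), (hcirc W X Y).1, circ_swap X W Y, mul_comm Z W,
      eq_sub_of_add_eq hZ, eq_sub_of_add_eq hX]
    abel

end Stmt1
end

section
/- Let ∘ be an A-bilinear, commutative and associative multiplication on T = Der_K(A) with unit field e, and suppose the integrability condition holds. Then the unit field e is an Euler field of weight 0, i.e. ⁅e, Z∘W⁆ = ⁅e,Z⁆∘W + Z∘⁅e,W⁆ for all Z,W ∈ T (the multiplication is constant along the unit field). (Remark 3.3 iv)) -/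
/-- **Remark 3.3 iv).** In an F-manifold (commutative associative multiplication with unit
field `e` satisfying the integrability condition), the unit field `e` is an Euler field of
weight 0: the multiplication is constant along the unit field. -/
theorem stmt_12
    (K : Type*) [Field K] [CharZero K]
    (A : Type*) [CommRing A] [Algebra K A]
    (mul : Derivation K A A → Derivation K A A → Derivation K A A)
    (mul_add : ∀ X X' Y : Derivation K A A, mul (X + X') Y = mul X Y + mul X' Y)
    (mul_smul : ∀ (f : A) (X Y : Derivation K A A), mul (f • X) Y = f • mul X Y)
    (mul_comm : ∀ X Y : Derivation K A A, mul X Y = mul Y X)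
    (mul_assoc : ∀ X Y Z : Derivation K A A, mul (mul X Y) Z = mul X (mul Y Z))
    (e : Derivation K A A)
    (e_unit : ∀ X : Derivation K A A, mul e X = X)
    (integrability : ∀ X Y Z W : Derivation K A A,
      ⁅mul X Y, mul Z W⁆ - mul ⁅mul X Y, Z⁆ W - mul ⁅mul X Y, W⁆ Z
        - mul X ⁅Y, mul Z W⁆ + mul (mul X ⁅Y, Z⁆) W + mul (mul X ⁅Y, W⁆) Z
        - mul Y ⁅X, mul Z W⁆ + mul (mul Y ⁅X, Z⁆) W + mul (mul Y ⁅X, W⁆) Z = 0) :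
    ∀ Z W : Derivation K A A, ⁅e, mul Z W⁆ = mul ⁅e, Z⁆ W + mul Z ⁅e, W⁆ := by
  intro Z W
  have h := integrability e e Z W
  simp only [e_unit] at h
  rw [mul_comm Z ⁅e, W⁆, ← sub_eq_zero, ← neg_eq_zero, ← h]
  abel
end

section
/- Let ∘ be an A-bilinear, commutative and associative multiplication on T = Der_K(A) satisfying the integrability condition, and let E ∈ T be an Euler field of weight d ∈ K. Write E^{∘k} for the k-th ∘-power of E (E^{∘1} = E, E^{∘(k+1)} = E ∘ E^{∘k}). Then for all integers n, m ≥ 1: ⁅E^{∘n}, E^{∘m}⁆ = d·(m − n)·E^{∘(m+n−1)}. (Identity (3.7)) -/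
namespace Stmt15

variable {K A : Type*} [Field K] [CharZero K] [CommRing A] [Algebra K A]

/-- `opow mul E k` is the `(k+1)`-st `∘`-power `E^{∘(k+1)}` of `E`
(so `opow mul E 0 = E^{∘1} = E`). -/
def opow (mul : Derivation K A A → Derivation K A A → Derivation K A A)
    (E : Derivation K A A) : ℕ → Derivation K A A
  | 0 => E
  | (k + 1) => mul E (opow mul E k)

/-- **Identity (3.7).** If the multiplication satisfies the integrability condition and `E`
is an Euler field of weight `d`, then for all `n, m ≥ 1`:
`⁅E^{∘n}, E^{∘m}⁆ = d·(m − n)·E^{∘(m+n−1)}`. (Here `n = n'+1`, `m = m'+1`.) -/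
theorem stmt_15
    (mul : Derivation K A A → Derivation K A A → Derivation K A A)
    (mul_add : ∀ X X' Y : Derivation K A A, mul (X + X') Y = mul X Y + mul X' Y)
    (mul_smul : ∀ (f : A) (X Y : Derivation K A A), mul (f • X) Y = f • mul X Y)
    (mul_comm : ∀ X Y : Derivation K A A, mul X Y = mul Y X)
    (mul_assoc : ∀ X Y Z : Derivation K A A, mul (mul X Y) Z = mul X (mul Y Z))
    (integrability : ∀ X Y Z W : Derivation K A A,
      ⁅mul X Y, mul Z W⁆ - mul ⁅mul X Y, Z⁆ W - mul ⁅mul X Y, W⁆ Z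
        - mul X ⁅Y, mul Z W⁆ + mul (mul X ⁅Y, Z⁆) W + mul (mul X ⁅Y, W⁆) Z
        - mul Y ⁅X, mul Z W⁆ + mul (mul Y ⁅X, Z⁆) W + mul (mul Y ⁅X, W⁆) Z = 0)
    (E : Derivation K A A) (d : K)
    (hE : ∀ X Y : Derivation K A A,
      ⁅E, mul X Y⁆ - mul ⁅E, X⁆ Y - mul X ⁅E, Y⁆ = d • mul X Y) :
    ∀ n' m' : ℕ,
      ⁅opow mul E n', opow mul E m'⁆ =
        (d * ((((m' + 1 : ℕ) : ℤ) - ((n' + 1 : ℕ) : ℤ) : ℤ) : K)) • opow mul E (m' + n') := by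
  have smul_mul (c : K) (X Y : Derivation K A A) : mul (c • X) Y = c • mul X Y := by
    rw [← algebraMap_smul A c X, mul_smul, algebraMap_smul]
  have mul_smul' (c : K) (X Y : Derivation K A A) : mul X (c • Y) = c • mul X Y := by
    rw [mul_comm, smul_mul, mul_comm]
  have mul_add' (X Y Z : Derivation K A A) : mul X (Y + Z) = mul X Y + mul X Z := by
    rw [mul_comm, mul_add, mul_comm Y, mul_comm Z]
  have mul_sub' (X Y Z : Derivation K A A) : mul X (Y - Z) = mul X Y - mul X Z := by
    rw [eq_sub_iff_add_eq, ← mul_add', sub_add_cancel]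
  have lie_mul (X Y Z W : Derivation K A A) :
      ⁅mul X Y, mul Z W⁆ - mul ⁅mul X Y, Z⁆ W - mul Z ⁅mul X Y, W⁆ =
        mul X (⁅Y, mul Z W⁆ - mul ⁅Y, Z⁆ W - mul Z ⁅Y, W⁆) +
        mul Y (⁅X, mul Z W⁆ - mul ⁅X, Z⁆ W - mul Z ⁅X, W⁆) := by
    have h := integrability X Y Z W
    simp only [mul_assoc] at h
    rw [mul_comm ⁅mul X Y, W⁆ Z, mul_comm ⁅Y, W⁆ Z, mul_comm ⁅X, W⁆ Z] at h
    simp only [mul_sub']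
    rw [← sub_eq_zero, ← h]
    abel
  have lie_opow_mul (n : ℕ) (W : Derivation K A A) :
      ⁅opow mul E n, mul E W⁆ - mul ⁅opow mul E n, E⁆ W - mul E ⁅opow mul E n, W⁆ =
        (d * (n + 1)) • mul (opow mul E n) W := by
    induction n with
    | zero => simpa [opow] using hE E W
    | succ n ih =>
      rw [opow, lie_mul, ih, hE, mul_smul', mul_smul', mul_assoc,
        ← mul_assoc (opow mul E n), mul_comm (opow mul E n) E, mul_assoc]
      push_cast
      module
  have lie_opow (m : ℕ) : ⁅E, opow mul E m⁆ = (d * m) • opow mul E m := by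
    induction m with
    | zero => simp [opow]
    | succ m ih =>
      have h := hE E (opow mul E m)
      rw [lie_self, ih, mul_smul', ← zero_smul K E, smul_mul, zero_smul, sub_zero,
        sub_eq_iff_eq_add] at h
      rw [opow, h]
      push_cast
      module
  have opow_lie (n : ℕ) : ⁅opow mul E n, E⁆ = (-(d * n)) • opow mul E n := by
    rw [← lie_skew, lie_opow, neg_smul]
  have mul_opow (n : ℕ) : mul E (opow mul E n) = opow mul E (n + 1) := rfl
  have mul_opow_opow (n m : ℕ) : mul (opow mul E n) (opow mul E m) = opow mul E (m + n + 1) := by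
    induction n with
    | zero => rfl
    | succ n ih =>
      rw [opow, mul_assoc, ih, mul_opow, Nat.add_assoc m n 1]
  intro n m
  induction m with
  | zero =>
    rw [opow, opow_lie, Nat.zero_add n]
    push_cast
    module
  | succ m ih =>
    have h := lie_opow_mul n (opow mul E m)
    rw [ih, opow_lie, smul_mul, mul_smul', mul_opow_opow, mul_opow,
      mul_opow, sub_eq_iff_eq_add, sub_eq_iff_eq_add] at h
    rw [Nat.add_right_comm m 1 n, h]
    push_cast
    module

end Stmt15
end

section
/- Let ∘ be an A-bilinear, commutative and associative multiplication on T = Der_K(A) satisfying the integrability condition, and let E ∈ T be an Euler field of weight 1. Then for all X, Y ∈ T: ⁅E∘X, E∘Y⁆ = E∘(⁅X, E∘Y⁆ − ⁅Y, E∘X⁆ − E∘⁅X,Y⁆). (Identity (13.5) of Remark 13.2, showing that E∘T is closed under the Lie bracket) -/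
/-- **Identity (13.5) of Remark 13.2.** If the multiplication satisfies the integrability
condition and `E` is an Euler field of weight 1, then
`⁅E∘X, E∘Y⁆ = E∘(⁅X, E∘Y⁆ − ⁅Y, E∘X⁆ − E∘⁅X,Y⁆)` for all `X, Y`;
in particular `E∘T` is closed under the Lie bracket. -/
theorem stmt_16
    (K : Type*) [Field K] [CharZero K]
    (A : Type*) [CommRing A] [Algebra K A]
    (mul : Derivation K A A → Derivation K A A → Derivation K A A)
    (mul_add : ∀ X X' Y : Derivation K A A, mul (X + X') Y = mul X Y + mul X' Y)
    (mul_smul : ∀ (f : A) (X Y : Derivation K A A), mul (f • X) Y = f • mul X Y)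
    (mul_comm : ∀ X Y : Derivation K A A, mul X Y = mul Y X)
    (mul_assoc : ∀ X Y Z : Derivation K A A, mul (mul X Y) Z = mul X (mul Y Z))
    (integrability : ∀ X Y Z W : Derivation K A A,
      ⁅mul X Y, mul Z W⁆ - mul ⁅mul X Y, Z⁆ W - mul ⁅mul X Y, W⁆ Z
        - mul X ⁅Y, mul Z W⁆ + mul (mul X ⁅Y, Z⁆) W + mul (mul X ⁅Y, W⁆) Z
        - mul Y ⁅X, mul Z W⁆ + mul (mul Y ⁅X, Z⁆) W + mul (mul Y ⁅X, W⁆) Z = 0)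
    (E : Derivation K A A)
    (hE : ∀ X Y : Derivation K A A,
      ⁅E, mul X Y⁆ - mul ⁅E, X⁆ Y - mul X ⁅E, Y⁆ = (1 : K) • mul X Y) :
    ∀ X Y : Derivation K A A,
      ⁅mul E X, mul E Y⁆ =
        mul E (⁅X, mul E Y⁆ - ⁅Y, mul E X⁆ - mul E ⁅X, Y⁆) := by
  intro X Y
  have mul_add_right (U V W : Derivation K A A) : mul W (U + V) = mul W U + mul W V := by
    rw [mul_comm, mul_add, mul_comm U, mul_comm V]
  have mul_neg_left (U W : Derivation K A A) : mul (-U) W = -mul U W := by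
    simpa using mul_smul (-1) U W
  have mul_neg_right (U W : Derivation K A A) : mul W (-U) = -mul W U := by
    rw [mul_comm, mul_neg_left, mul_comm]
  have zero_mul_left (U : Derivation K A A) : mul 0 U = 0 := by simpa using mul_smul 0 0 U
  have mul_zero_right (U : Derivation K A A) : mul U 0 = 0 := by rw [mul_comm, zero_mul_left]
  have bracket_E_mul (U : Derivation K A A) :
      ⁅mul E U, E⁆ = -(mul E ⁅E, U⁆ + mul E U) := by
    have h := hE E U
    rw [lie_self, zero_mul_left, one_smul, sub_zero, sub_eq_iff_eq_add] at h
    rw [← lie_skew, h, add_comm]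
  have hEY : ⁅E, mul E Y⁆ = mul E ⁅E, Y⁆ + mul E Y := by
    rw [← lie_skew, bracket_E_mul, neg_neg]
  have h := integrability E X E Y
  rw [bracket_E_mul, hEY, lie_self, ← lie_skew X E, ← lie_skew (mul E X) Y] at h
  have comm_left (U V W : Derivation K A A) : mul U (mul V W) = mul V (mul U W) := by
    rw [← mul_assoc, mul_comm U V, mul_assoc]
  simp only [sub_eq_add_neg, mul_add, mul_add_right, mul_neg_left, mul_neg_right,
    mul_zero_right, zero_mul_left, mul_assoc, mul_comm, comm_left] at h ⊢
  rw [← sub_eq_zero, ← h]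
  abel
end

section
/- Let ∘ be an A-bilinear, commutative and associative multiplication on T = Der_K(A) with unit field e, satisfying the integrability condition, and suppose e = e_1 + … + e_l with e_j ∘ e_k = 0 for j ≠ k and e_k ∘ e_k = e_k (a decomposition of the unit field into ∘-orthogonal idempotent vector fields). Then each e_k is an Euler field of weight 0, i.e. ⁅e_k, X∘Y⁆ = ⁅e_k,X⁆∘Y + X∘⁅e_k,Y⁆ for all X,Y ∈ T, and ⁅e_j, e_k⁆ = 0 for all j, k. (Claims i) and ii) in the proof of Theorem 4.2) -/
/-- If `i` is idempotent for an associative, right-additive operation, then `i` cannot act on a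
nonzero element `p` as multiplication by one half. -/
theorem eq_zero_of_idempotent_of_eq_add_self {M : Type*} [AddCommGroup M] (mul : M → M → M)
    (mul_add : ∀ X Y Z : M, mul X (Y + Z) = mul X Y + mul X Z)
    (mul_assoc : ∀ X Y Z : M, mul (mul X Y) Z = mul X (mul Y Z))
    {i p : M} (hi : mul i i = i) (hp : p = mul i p + mul i p) : p = 0 := by
  have h : mul i p = mul i p + mul i p := by
    conv_lhs => rw [hp, mul_add, ← mul_assoc, hi]
  have h0 : mul i p = 0 := by simpa using h
  rw [hp, h0, add_zero]

/-- **Claims i) and ii) in the proof of Theorem 4.2.** If the unit field `e` of an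
F-manifold decomposes as `e = e_1 + … + e_l` into `∘`-orthogonal idempotent vector fields,
then each `e_k` is an Euler field of weight 0 and `⁅e_j, e_k⁆ = 0` for all `j, k`. -/
theorem stmt_17
    (K : Type*) [Field K] [CharZero K]
    (A : Type*) [CommRing A] [Algebra K A]
    (mul : Derivation K A A → Derivation K A A → Derivation K A A)
    (mul_add : ∀ X X' Y : Derivation K A A, mul (X + X') Y = mul X Y + mul X' Y)
    (mul_smul : ∀ (f : A) (X Y : Derivation K A A), mul (f • X) Y = f • mul X Y)
    (mul_comm : ∀ X Y : Derivation K A A, mul X Y = mul Y X)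
    (mul_assoc : ∀ X Y Z : Derivation K A A, mul (mul X Y) Z = mul X (mul Y Z))
    (e : Derivation K A A)
    (e_unit : ∀ X : Derivation K A A, mul e X = X)
    (integrability : ∀ X Y Z W : Derivation K A A,
      ⁅mul X Y, mul Z W⁆ - mul ⁅mul X Y, Z⁆ W - mul ⁅mul X Y, W⁆ Z
        - mul X ⁅Y, mul Z W⁆ + mul (mul X ⁅Y, Z⁆) W + mul (mul X ⁅Y, W⁆) Z
        - mul Y ⁅X, mul Z W⁆ + mul (mul Y ⁅X, Z⁆) W + mul (mul Y ⁅X, W⁆) Z = 0)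
    (l : ℕ) (es : Fin l → Derivation K A A)
    (hsum : e = ∑ k, es k)
    (horth : ∀ j k, j ≠ k → mul (es j) (es k) = 0)
    (hidem : ∀ k, mul (es k) (es k) = es k) :
    (∀ k, ∀ X Y : Derivation K A A,
      ⁅es k, mul X Y⁆ = mul ⁅es k, X⁆ Y + mul X ⁅es k, Y⁆) ∧
    (∀ j k, ⁅es j, es k⁆ = 0) := by
  have mul_add' : ∀ X Y Z, mul X (Y + Z) = mul X Y + mul X Z := fun X Y Z => by
    rw [mul_comm, mul_add, mul_comm Y, mul_comm Z]
  have mul_sub' : ∀ X Y Z, mul X (Y - Z) = mul X Y - mul X Z := fun X Y Z => by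
    rw [eq_sub_iff_add_eq, ← mul_add', sub_add_cancel]
  have euler : ∀ k X Y, ⁅es k, mul X Y⁆ = mul ⁅es k, X⁆ Y + mul X ⁅es k, Y⁆ := by
    intro k X Y
    have h := integrability (es k) (es k) X Y
    rw [hidem] at h
    rw [mul_comm X ⁅es k, Y⁆, ← sub_eq_zero, ← sub_sub]
    refine eq_zero_of_idempotent_of_eq_add_self mul mul_add' mul_assoc (hidem k) ?_
    rw [mul_sub', mul_sub', ← mul_assoc, ← mul_assoc, ← sub_eq_zero, ← h]
    abel
  refine ⟨euler, fun j k => ?_⟩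
  refine eq_zero_of_idempotent_of_eq_add_self mul mul_add' mul_assoc (hidem k) ?_
  have h := euler j (es k) (es k)
  rwa [hidem, mul_comm _ (es k)] at h
end

section
/- Let ∘ be an A-bilinear, commutative and associative multiplication on T = Der_K(A) with unit field e, satisfying the integrability condition, and suppose e = e_1 + … + e_l with e_j ∘ e_k = 0 for j ≠ k and e_k ∘ e_k = e_k. Let T_k := e_k ∘ T = {e_k ∘ X : X ∈ T} be the corresponding A-submodules of T (so T = T_1 ⊕ … ⊕ T_l). Then for all j, k: ⁅e_j, X⁆ ∈ T_k whenever X ∈ T_k, and ⁅X, Y⁆ ∈ T_j + T_k whenever X ∈ T_j and Y ∈ T_k. (Claims iii) and iv) in the proof of Theorem 4.2: the eigenspace submodules and all their partial sums are closed under the Lie bracket) -/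
section LeibnizDefect

variable {L : Type*} [NonUnitalCommRing L] (br : L → L → L)

/-- The failure of `br X` to be a derivation of the product. -/
def leibnizDefect (X Z W : L) : L :=
  br X (Z * W) - br X Z * W - br X W * Z

theorem eq_zero_of_eq_mul_add_mul {a x : L} (ha : a * a = a) (h : x = a * x + a * x) :
    x = 0 := by
  have hax : a * x = a * x + a * x := by
    conv_lhs => rw [h]
    rw [mul_add, ← mul_assoc, ha]
  have h0 : a * x = 0 := left_eq_add.mp hax
  rw [h, h0, add_zero]

variable {br}
variable (hbr : ∀ X Y Z W, leibnizDefect br (X * Y) Z W =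
  X * leibnizDefect br Y Z W + Y * leibnizDefect br X Z W)
include hbr

theorem leibnizDefect_idempotent {a : L} (ha : a * a = a) (Z W : L) :
    leibnizDefect br a Z W = 0 := by
  refine eq_zero_of_eq_mul_add_mul ha ?_
  have h := hbr a a Z W
  rwa [ha] at h

theorem bracket_idempotent_mul {a : L} (ha : a * a = a) (Z W : L) :
    br a (Z * W) = br a Z * W + br a W * Z := by
  have h := leibnizDefect_idempotent hbr ha Z W
  rw [leibnizDefect, sub_sub, sub_eq_zero] at h
  exact h

theorem bracket_idempotent_idempotent {a b : L} (ha : a * a = a) (hb : b * b = b) :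
    br a b = 0 := by
  refine eq_zero_of_eq_mul_add_mul hb ?_
  have h := bracket_idempotent_mul hbr ha b b
  rwa [hb, mul_comm (br a b) b] at h

theorem bracket_idempotent_idempotent_mul {a b : L} (ha : a * a = a) (hb : b * b = b) (X : L) :
    br a (b * X) = b * br a X := by
  rw [bracket_idempotent_mul hbr ha, bracket_idempotent_idempotent hbr ha hb, zero_mul, zero_add,
    mul_comm]

theorem leibnizDefect_idempotent_mul {a : L} (ha : a * a = a) (X Z W : L) :
    leibnizDefect br (a * X) Z W = a * leibnizDefect br X Z W := by
  rw [hbr, leibnizDefect_idempotent hbr ha, mul_zero, add_zero]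

theorem exists_bracket_eq_idempotent_mul_add (hskew : ∀ X Y, br X Y = -br Y X)
    {a b : L} (ha : a * a = a) (hb : b * b = b) (X Y : L) :
    ∃ U V, br (a * X) (b * Y) = a * U + b * V := by
  refine ⟨leibnizDefect br X b (b * Y) - br b X * (b * Y), br (a * X) (b * Y), ?_⟩
  have h := leibnizDefect_idempotent_mul hbr ha X b (b * Y)
  rw [mul_sub, ← h, leibnizDefect, ← mul_assoc b b Y, hb, hskew (a * X) b,
    bracket_idempotent_idempotent_mul hbr hb ha, mul_comm b (br _ _), neg_mul, mul_assoc a]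
  abel

end LeibnizDefect

/-- **Claims iii) and iv) in the proof of Theorem 4.2.** With `e = e_1 + … + e_l` a
decomposition of the unit field of an F-manifold into `∘`-orthogonal idempotent vector
fields and `T_k := e_k ∘ T`, one has `⁅e_j, T_k⁆ ⊆ T_k` and `⁅T_j, T_k⁆ ⊆ T_j + T_k` for
all `j, k`. -/
theorem stmt_18
    (K : Type*) [Field K] [CharZero K]
    (A : Type*) [CommRing A] [Algebra K A]
    (mul : Derivation K A A → Derivation K A A → Derivation K A A)
    (mul_add : ∀ X X' Y : Derivation K A A, mul (X + X') Y = mul X Y + mul X' Y)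
    (mul_smul : ∀ (f : A) (X Y : Derivation K A A), mul (f • X) Y = f • mul X Y)
    (mul_comm : ∀ X Y : Derivation K A A, mul X Y = mul Y X)
    (mul_assoc : ∀ X Y Z : Derivation K A A, mul (mul X Y) Z = mul X (mul Y Z))
    (e : Derivation K A A)
    (e_unit : ∀ X : Derivation K A A, mul e X = X)
    (integrability : ∀ X Y Z W : Derivation K A A,
      ⁅mul X Y, mul Z W⁆ - mul ⁅mul X Y, Z⁆ W - mul ⁅mul X Y, W⁆ Z
        - mul X ⁅Y, mul Z W⁆ + mul (mul X ⁅Y, Z⁆) W + mul (mul X ⁅Y, W⁆) Z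
        - mul Y ⁅X, mul Z W⁆ + mul (mul Y ⁅X, Z⁆) W + mul (mul Y ⁅X, W⁆) Z = 0)
    (l : ℕ) (es : Fin l → Derivation K A A)
    (hsum : e = ∑ k, es k)
    (horth : ∀ j k, j ≠ k → mul (es j) (es k) = 0)
    (hidem : ∀ k, mul (es k) (es k) = es k) :
    (∀ j k, ∀ X : Derivation K A A,
      (∃ X' : Derivation K A A, X = mul (es k) X') →
      ∃ X'' : Derivation K A A, ⁅es j, X⁆ = mul (es k) X'') ∧
    (∀ j k, ∀ X Y : Derivation K A A,
      (∃ X' : Derivation K A A, X = mul (es j) X') →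
      (∃ Y' : Derivation K A A, Y = mul (es k) Y') →
      ∃ U V : Derivation K A A, ⁅X, Y⁆ = mul (es j) U + mul (es k) V) := by
  let _ : NonUnitalCommRing (Derivation K A A) :=
    { (inferInstance : AddCommGroup (Derivation K A A)) with
      mul := mul
      left_distrib := fun X Y Z => by
        change mul X (Y + Z) = mul X Y + mul X Z
        rw [mul_comm, mul_add, mul_comm Y, mul_comm Z]
      right_distrib := mul_add
      zero_mul := fun X => by
        change mul 0 X = 0
        simpa using mul_smul 0 0 X
      mul_zero := fun X => by
        change mul X 0 = 0
        rw [mul_comm]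
        simpa using mul_smul 0 0 X
      mul_assoc := mul_assoc
      mul_comm := mul_comm }
  have hbr : ∀ X Y Z W : Derivation K A A, leibnizDefect Bracket.bracket (X * Y) Z W =
      X * leibnizDefect Bracket.bracket Y Z W + Y * leibnizDefect Bracket.bracket X Z W := by
    intro X Y Z W
    have h : ⁅X * Y, Z * W⁆ - ⁅X * Y, Z⁆ * W - ⁅X * Y, W⁆ * Z
        - X * ⁅Y, Z * W⁆ + (X * ⁅Y, Z⁆) * W + (X * ⁅Y, W⁆) * Z
        - Y * ⁅X, Z * W⁆ + (Y * ⁅X, Z⁆) * W + (Y * ⁅X, W⁆) * Z = 0 := integrability X Y Z W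
    rw [← sub_eq_zero, ← h]
    simp only [leibnizDefect, mul_sub, _root_.mul_assoc]
    abel
  refine ⟨?_, ?_⟩
  · rintro j k _ ⟨X, rfl⟩
    exact ⟨⁅es j, X⁆, bracket_idempotent_idempotent_mul hbr (hidem j) (hidem k) X⟩
  · rintro j k _ _ ⟨X, rfl⟩ ⟨Y, rfl⟩
    exact exists_bracket_eq_idempotent_mul_add hbr (fun X Y => (lie_skew X Y).symm)
      (hidem j) (hidem k) X Y
end

section
/- Let A = ℂ[t_1,t_2] be the polynomial ring in two variables, T = Der_ℂ(A) its A-module of ℂ-linear derivations with commutator bracket, and ∂_1, ∂_2 ∈ T the coordinate partial derivatives, which form an A-basis of T. Fix an integer m ≥ 2 and let ∘ be the unique A-bilinear commutative multiplication on T with ∂_1∘∂_1 = ∂_1, ∂_1∘∂_2 = ∂_2 and ∂_2∘∂_2 = t_2^{m−2}·∂_1. Then ∘ is associative with unit field e = ∂_1, it satisfies the integrability condition (so this defines the F-manifold I_2(m), with I_2(2) = A_1^2), and E := t_1·∂_1 + (2/m)·t_2·∂_2 is an Euler field of weight 1. (Example 4.3 iv) and part of Theorem 12.1 a)) -/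
namespace Stmt19

/-- The Euler field `E = t₁·∂₁ + (2/m)·t₂·∂₂` on `ℂ² = Spec ℂ[t₁,t₂]`. -/
noncomputable def E (m : ℕ) : Derivation ℂ (MvPolynomial (Fin 2) ℂ) (MvPolynomial (Fin 2) ℂ) :=
  (MvPolynomial.X 0 : MvPolynomial (Fin 2) ℂ) • MvPolynomial.pderiv (0 : Fin 2)
    + (MvPolynomial.C (2 / (m : ℂ)) * MvPolynomial.X 1 : MvPolynomial (Fin 2) ℂ) •
        MvPolynomial.pderiv (1 : Fin 2)

open MvPolynomial in
/-- A derivation of `ℂ[t₁,t₂]` is the combination of the partial derivatives given by its values on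
the coordinates. -/
theorem exists_eq_smul_pderiv_add
    (D : Derivation ℂ (MvPolynomial (Fin 2) ℂ) (MvPolynomial (Fin 2) ℂ)) :
    ∃ a b : MvPolynomial (Fin 2) ℂ, D = a • pderiv (0 : Fin 2) + b • pderiv (1 : Fin 2) := by
  refine ⟨D (X 0), D (X 1), derivation_ext fun i => ?_⟩
  fin_cases i <;> simp [pderiv_X]

open MvPolynomial in
/-- The commutator of two derivations in coordinates. -/
theorem commutator_smul_pderiv (a b c d : MvPolynomial (Fin 2) ℂ) :
    ⁅a • (pderiv (0 : Fin 2) : Derivation ℂ (MvPolynomial (Fin 2) ℂ) _) + b • pderiv (1 : Fin 2),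
      c • (pderiv (0 : Fin 2) : Derivation ℂ (MvPolynomial (Fin 2) ℂ) _) + d • pderiv (1 : Fin 2)⁆ =
    (a * pderiv 0 c + b * pderiv 1 c - c * pderiv 0 a - d * pderiv 1 a) •
        (pderiv (0 : Fin 2) : Derivation ℂ (MvPolynomial (Fin 2) ℂ) _) +
      (a * pderiv 0 d + b * pderiv 1 d - c * pderiv 0 b - d * pderiv 1 b) •
        pderiv (1 : Fin 2) := by
  refine derivation_ext fun i => ?_
  fin_cases i <;> simp [Derivation.commutator_apply, pderiv_X] <;> ring

open MvPolynomial in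
/-- On `t₂^n`, the vector field `t₂·∂₂` acts by multiplication by `n`. -/
theorem X_one_mul_pderiv_X_one_pow (n : ℕ) :
    (X 1 : MvPolynomial (Fin 2) ℂ) * pderiv (1 : Fin 2) (X 1 ^ n) =
      (n : MvPolynomial (Fin 2) ℂ) * X 1 ^ n := by
  cases n with
  | zero => simp
  | succ k =>
    simp only [Derivation.leibniz_pow, pderiv_X_self, Nat.add_sub_cancel, smul_eq_mul, nsmul_eq_mul]
    ring

open MvPolynomial in
/-- **Example 4.3 iv) and part of Theorem 12.1 a) (the F-manifold `I₂(m)`).** Let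
`A = ℂ[t₁,t₂]`, `T = Der_ℂ(A)` with `A`-basis `∂₁, ∂₂`, and `m ≥ 2`. The unique
`A`-bilinear commutative multiplication `∘` on `T` with `∂₁∘∂₁ = ∂₁`, `∂₁∘∂₂ = ∂₂` and
`∂₂∘∂₂ = t₂^{m−2}·∂₁` is associative with unit field `e = ∂₁`, satisfies the integrability
condition, and `E = t₁·∂₁ + (2/m)·t₂·∂₂` is an Euler field of weight 1. -/
theorem stmt_19
    (m : ℕ) (hm : 2 ≤ m)
    (mul : Derivation ℂ (MvPolynomial (Fin 2) ℂ) (MvPolynomial (Fin 2) ℂ) →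
      Derivation ℂ (MvPolynomial (Fin 2) ℂ) (MvPolynomial (Fin 2) ℂ) →
      Derivation ℂ (MvPolynomial (Fin 2) ℂ) (MvPolynomial (Fin 2) ℂ))
    (mul_add : ∀ X X' Y, mul (X + X') Y = mul X Y + mul X' Y)
    (mul_smul : ∀ (f : MvPolynomial (Fin 2) ℂ) (X Y), mul (f • X) Y = f • mul X Y)
    (mul_comm : ∀ X Y, mul X Y = mul Y X)
    (h00 : mul (MvPolynomial.pderiv (0 : Fin 2)) (MvPolynomial.pderiv (0 : Fin 2)) =
      MvPolynomial.pderiv (0 : Fin 2))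
    (h01 : mul (MvPolynomial.pderiv (0 : Fin 2)) (MvPolynomial.pderiv (1 : Fin 2)) =
      MvPolynomial.pderiv (1 : Fin 2))
    (h11 : mul (MvPolynomial.pderiv (1 : Fin 2)) (MvPolynomial.pderiv (1 : Fin 2)) =
      (MvPolynomial.X 1 ^ (m - 2) : MvPolynomial (Fin 2) ℂ) •
        MvPolynomial.pderiv (0 : Fin 2)) :
    (∀ X Y Z, mul (mul X Y) Z = mul X (mul Y Z)) ∧
    (∀ X, mul (MvPolynomial.pderiv (0 : Fin 2)) X = X) ∧
    (∀ X Y Z W,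
      ⁅mul X Y, mul Z W⁆ - mul ⁅mul X Y, Z⁆ W - mul ⁅mul X Y, W⁆ Z
        - mul X ⁅Y, mul Z W⁆ + mul (mul X ⁅Y, Z⁆) W + mul (mul X ⁅Y, W⁆) Z
        - mul Y ⁅X, mul Z W⁆ + mul (mul Y ⁅X, Z⁆) W + mul (mul Y ⁅X, W⁆) Z = 0) ∧
    (∀ X Y, ⁅E m, mul X Y⁆ - mul ⁅E m, X⁆ Y - mul X ⁅E m, Y⁆ = mul X Y) := by
  have add_smul_pderiv (a b c d : MvPolynomial (Fin 2) ℂ) :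
      (a • pderiv (0 : Fin 2) + b • pderiv (1 : Fin 2) :
          Derivation ℂ (MvPolynomial (Fin 2) ℂ) (MvPolynomial (Fin 2) ℂ)) +
        (c • pderiv (0 : Fin 2) + d • pderiv (1 : Fin 2)) =
      (a + c) • pderiv (0 : Fin 2) + (b + d) • pderiv (1 : Fin 2) := by
    module
  have sub_smul_pderiv (a b c d : MvPolynomial (Fin 2) ℂ) :
      (a • pderiv (0 : Fin 2) + b • pderiv (1 : Fin 2) :
          Derivation ℂ (MvPolynomial (Fin 2) ℂ) (MvPolynomial (Fin 2) ℂ)) -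
        (c • pderiv (0 : Fin 2) + d • pderiv (1 : Fin 2)) =
      (a - c) • pderiv (0 : Fin 2) + (b - d) • pderiv (1 : Fin 2) := by
    module
  have mul_smul_pderiv (a b c d : MvPolynomial (Fin 2) ℂ) :
      mul (a • pderiv (0 : Fin 2) + b • pderiv (1 : Fin 2))
        (c • pderiv (0 : Fin 2) + d • pderiv (1 : Fin 2)) =
      (a * c + X 1 ^ (m - 2) * (b * d)) • pderiv (0 : Fin 2) +
        (a * d + b * c) • pderiv (1 : Fin 2) := by
    have h10 : mul (pderiv (1 : Fin 2)) (pderiv (0 : Fin 2)) = pderiv (1 : Fin 2) := by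
      rw [mul_comm, h01]
    have mul_add' (U V W) : mul U (V + W) = mul U V + mul U W := by
      rw [mul_comm, mul_add, mul_comm V, mul_comm W]
    have mul_smul' (f : MvPolynomial (Fin 2) ℂ) (U V) : mul U (f • V) = f • mul U V := by
      rw [mul_comm, mul_smul, mul_comm V]
    simp only [mul_add, mul_smul, mul_add', mul_smul', h00, h01, h10, h11]
    module
  have pderiv_zero_pow : pderiv (0 : Fin 2) (X 1 ^ (m - 2) : MvPolynomial (Fin 2) ℂ) = 0 := by
    simp [Derivation.leibniz_pow, pderiv_X]
  have euler_pow := X_one_mul_pderiv_X_one_pow (m - 2)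
  generalize (X 1 ^ (m - 2) : MvPolynomial (Fin 2) ℂ) = p at *
  refine ⟨fun U V W => ?_, fun U => ?_, fun U V W Z => ?_, fun U V => ?_⟩
  · obtain ⟨a, b, rfl⟩ := exists_eq_smul_pderiv_add U
    obtain ⟨c, d, rfl⟩ := exists_eq_smul_pderiv_add V
    obtain ⟨e, f, rfl⟩ := exists_eq_smul_pderiv_add W
    simp only [mul_smul_pderiv]
    congr 2 <;> ring
  · obtain ⟨a, b, rfl⟩ := exists_eq_smul_pderiv_add U
    simpa using mul_smul_pderiv 1 0 a b
  · obtain ⟨a, b, rfl⟩ := exists_eq_smul_pderiv_add U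
    obtain ⟨c, d, rfl⟩ := exists_eq_smul_pderiv_add V
    obtain ⟨e, f, rfl⟩ := exists_eq_smul_pderiv_add W
    obtain ⟨g, h, rfl⟩ := exists_eq_smul_pderiv_add Z
    simp only [mul_smul_pderiv, commutator_smul_pderiv, add_smul_pderiv, sub_smul_pderiv,
      map_add, Derivation.leibniz, smul_eq_mul, pderiv_zero_pow]
    convert add_zero (0 : Derivation ℂ (MvPolynomial (Fin 2) ℂ) (MvPolynomial (Fin 2) ℂ)) using 2
    all_goals
      convert zero_smul (MvPolynomial (Fin 2) ℂ) _ using 2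
      ring
  · obtain ⟨a, b, rfl⟩ := exists_eq_smul_pderiv_add U
    obtain ⟨c, d, rfl⟩ := exists_eq_smul_pderiv_add V
    have weight : (C (2 / (m : ℂ)) : MvPolynomial (Fin 2) ℂ) *
        (((m - 2 : ℕ) : MvPolynomial (Fin 2) ℂ) + 2) = 2 := by
      have hm0 : (m : ℂ) ≠ 0 := by
        exact_mod_cast (by omega : m ≠ 0)
      have hcast : (((m - 2 : ℕ) : MvPolynomial (Fin 2) ℂ) + 2) = C (m : ℂ) := by
        rw [map_natCast]
        exact_mod_cast congrArg (Nat.cast (R := MvPolynomial (Fin 2) ℂ)) (Nat.sub_add_cancel hm)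
      rw [hcast, ← C_mul, div_mul_cancel₀ _ hm0, map_ofNat]
    have hX01 : pderiv (0 : Fin 2) (X 1 : MvPolynomial (Fin 2) ℂ) = 0 := by simp [pderiv_X]
    have hX10 : pderiv (1 : Fin 2) (X 0 : MvPolynomial (Fin 2) ℂ) = 0 := by simp [pderiv_X]
    simp only [E, mul_smul_pderiv, commutator_smul_pderiv, sub_smul_pderiv,
      map_add, Derivation.leibniz, smul_eq_mul, pderiv_zero_pow, pderiv_X_self, hX01, hX10,
      pderiv_C]
    congr 2
    · linear_combination (C (2 / (m : ℂ)) * b * d) * euler_pow + p * b * d * weight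
    · ring

end Stmt19
end
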